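/- arXiv:2002.10811 — 5 statements merged into one kernel-verified Lean document; each statement's English description precedes it below -/
import Mathlib

section
/- Let n ≥ 1, let B be an n×n real symmetric positive semidefinite matrix, let a > 0, b > 0, and set K = a·I + B. If 0 < Δt ≤ a/b, then for every V ∈ ℝⁿ, ‖V - b·Δt·K⁻¹V‖₂ ≤ ‖V‖₂, where ‖·‖₂ is the Euclidean norm. -/
/-- If `B` is symmetric positive semidefinite, `K = a·I + B`, and `0 < Δt ≤ a/b`, then
`‖V - b·Δt·K⁻¹V‖₂ ≤ ‖V‖₂` for every `V`. -/
theorem stmt4 (n : ℕ) (hn : 1 ≤ n) (B : Matrix (Fin n) (Fin n) ℝ)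
    (hsymm : B.IsSymm) (hB : B.PosSemidef) (a b : ℝ) (ha : 0 < a) (hb : 0 < b)
    (K : Matrix (Fin n) (Fin n) ℝ) (hK : K = a • (1 : Matrix (Fin n) (Fin n) ℝ) + B)
    (Δt : ℝ) (hΔt : 0 < Δt) (hΔt' : Δt ≤ a / b) :
    ∀ V : EuclideanSpace ℝ (Fin n),
      ‖V - (b * Δt) • (WithLp.equiv 2 (Fin n → ℝ)).symm
          ((K⁻¹).mulVec (WithLp.equiv 2 (Fin n → ℝ) V))‖ ≤ ‖V‖ := by
  intro V
  have hc : b * Δt ≤ a := by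
    rw [le_div_iff₀ hb] at hΔt'
    linarith
  have hc0 : 0 < b * Δt := mul_pos hb hΔt
  have hKpd : K.PosDef := by
    rw [hK]
    exact (Matrix.PosDef.one.smul ha).add_posSemidef hB
  have hdet : IsUnit K.det := (Matrix.isUnit_iff_isUnit_det K).1 hKpd.isUnit
  obtain ⟨v⟩ := V
  set w : Fin n → ℝ := (K⁻¹).mulVec v with hw
  have hv : v = a • w + B.mulVec w := by
    have h1 : K.mulVec w = v := by
      rw [hw, Matrix.mulVec_mulVec, Matrix.mul_nonsing_inv K hdet, Matrix.one_mulVec]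
    rw [← h1, hK, Matrix.add_mulVec, Matrix.smul_mulVec, Matrix.one_mulVec]
  have hBw : 0 ≤ w ⬝ᵥ B.mulVec w := by
    simpa using hB.dotProduct_mulVec_nonneg w
  have hww : 0 ≤ w ⬝ᵥ w := Finset.sum_nonneg fun i _ => mul_self_nonneg (w i)
  have hwv : w ⬝ᵥ v = a * (w ⬝ᵥ w) + w ⬝ᵥ B.mulVec w := by
    conv_lhs => rw [hv]
    rw [dotProduct_add, dotProduct_smul, smul_eq_mul]
  have key : (v - (b * Δt) • w) ⬝ᵥ (v - (b * Δt) • w) ≤ v ⬝ᵥ v := by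
    have e : (v - (b * Δt) • w) ⬝ᵥ (v - (b * Δt) • w)
        = v ⬝ᵥ v - 2 * (b * Δt) * (w ⬝ᵥ v) + (b * Δt) * (b * Δt) * (w ⬝ᵥ w) := by
      simp only [sub_dotProduct, dotProduct_sub, smul_dotProduct, dotProduct_smul, smul_eq_mul,
        dotProduct_comm v w]
      ring
    rw [e, hwv]
    have h1 := mul_nonneg hc0.le hBw
    have h2 := mul_nonneg (mul_nonneg hc0.le (sub_nonneg.2 hc)) hww
    have h3 := mul_nonneg (mul_nonneg hc0.le ha.le) hww
    linarith
  have hn2 : ∀ u : Fin n → ℝ, ‖(WithLp.toLp 2 u : EuclideanSpace ℝ (Fin n))‖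
      = Real.sqrt (u ⬝ᵥ u) := by
    intro u
    rw [EuclideanSpace.norm_eq]
    simp [dotProduct, sq]
  have := Real.sqrt_le_sqrt key
  rw [← hn2, ← hn2] at this
  exact this
end

section
/- For an integer m ≥ 0, let L_m : ℝ → ℝ denote the Legendre polynomial given by Rodrigues' formula L_m(x) = (1/(2^m m!)) (d/dx)^m (x² - 1)^m. For k ≥ 0 set c_k = 1/√(4k+6) and φ_k(x) = c_k (L_k(x) - L_{k+2}(x)). Then for all integers j, k ≥ 0, ∫_{-1}^{1} φ_j'(x) φ_k'(x) dx = δ_{jk} (equal to 1 if j = k and 0 otherwise). -/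
open Real

namespace Leg
open Polynomial

noncomputable def W (m : ℕ) : ℝ[X] := (X ^ 2 - 1) ^ m

lemma iter_eval (p : ℝ[X]) (m : ℕ) :
    iteratedDeriv m (fun y => p.eval y) = fun y => (derivative^[m] p).eval y := by
  induction m with
  | zero => simp
  | succ n ih =>
    rw [iteratedDeriv_succ, ih, Function.iterate_succ_apply']
    funext y
    exact Polynomial.deriv _

lemma dW (m : ℕ) : derivative (W (m+1)) = C (2 * ((m:ℝ) + 1)) * (X * W m) := by
  simp only [W, derivative_pow, derivative_sub, derivative_X, derivative_one]
  simp
  ring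

lemma dXW (m : ℕ) : derivative (X * W (m+1)) =
    C (2 * (m:ℝ) + 3) * W (m+1) + C (2 * ((m:ℝ) + 1)) * W m := by
  have c2 : (C 2 : ℝ[X]) = 2 := rfl
  have c3 : (C 3 : ℝ[X]) = 3 := rfl
  have c4 : (C 4 : ℝ[X]) = 4 := rfl
  rw [derivative_mul, dW]
  simp [W, c2, c3]
  ring

lemma ddW (m : ℕ) : derivative (derivative (W (m+2))) =
    C (2 * ((m:ℝ) + 2) * (2 * m + 3)) * W (m+1) + C (4 * ((m:ℝ)+2) * (m+1)) * W m := by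
  rw [dW, derivative_C_mul, dXW]
  have c2 : (C 2 : ℝ[X]) = 2 := rfl
  have c3 : (C 3 : ℝ[X]) = 3 := rfl
  have c4 : (C 4 : ℝ[X]) = 4 := rfl
  simp [c2, c3, c4]
  push_cast
  ring

noncomputable def K (m : ℕ) : ℝ := 1 / (2 ^ m * (Nat.factorial m : ℝ))

noncomputable def P (m : ℕ) : ℝ[X] := C (K m) * derivative^[m] (W m)

lemma dP (m : ℕ) : derivative (P m - P (m+2)) = C (-(2 * (m:ℝ) + 3)) * P (m+1) := by
  have h : derivative (derivative^[m+2] (W (m+2))) =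
      C (2 * ((m:ℝ) + 2) * (2 * m + 3)) * derivative^[m+1] (W (m+1))
      + C (4 * ((m:ℝ)+2) * (m+1)) * derivative (derivative^[m] (W m)) := by
    rw [← Function.iterate_succ_apply' derivative, ← Function.iterate_succ_apply' derivative]
    change derivative^[m+1] (derivative (derivative (W (m+2)))) = _
    rw [ddW, iterate_map_add, iterate_derivative_C_mul, iterate_derivative_C_mul]
  have k1 : K (m+1) = K (m+2) * (2 * ((m:ℝ)+2)) := by
    simp only [K, Nat.factorial_succ]; push_cast; field_simp; ring
  have k0 : K m = K (m+2) * (4 * ((m:ℝ)+2) * (m+1)) := by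
    simp only [K, Nat.factorial_succ]; push_cast; field_simp; ring
  simp only [P, derivative_sub, derivative_C_mul, h, k1, k0]
  simp only [C_mul, C_neg]
  ring

noncomputable def J (p : ℝ[X]) : ℝ := ∫ x in (-1:ℝ)..1, p.eval x

lemma J_add (p q : ℝ[X]) : J (p + q) = J p + J q := by
  simp only [J, eval_add]
  exact intervalIntegral.integral_add (p.continuous.intervalIntegrable _ _)
    (q.continuous.intervalIntegrable _ _)

lemma J_C (a : ℝ) (q : ℝ[X]) : J (C a * q) = a * J q := by
  simp [J]

lemma J_d (p : ℝ[X]) : J (derivative p) = p.eval 1 - p.eval (-1) := by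
  simp only [J]
  exact intervalIntegral.integral_eq_sub_of_hasDerivAt (fun x _ => p.hasDerivAt x)
    ((derivative p).continuous.intervalIntegrable _ _)

lemma vanish (m j : ℕ) (h : j < m) (a : ℝ) (ha : a ^ 2 = 1) :
    (derivative^[j] (W m)).eval a = 0 := by
  have h1 : (X ^ 2 - 1 : ℝ[X]) ^ (m - j) ∣ derivative^[j] (W m) :=
    pow_sub_dvd_iterate_derivative_of_pow_dvd _ (dvd_refl _)
  obtain ⟨q, hq⟩ := h1
  rw [hq]
  simp [ha, show m - j ≠ 0 by omega]

lemma parts (m : ℕ) : ∀ (j : ℕ) (_ : j ≤ m) (q : ℝ[X]),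
    J (derivative^[j] (W m) * q) = (-1) ^ j * J (W m * derivative^[j] q) := by
  intro j
  induction j with
  | zero => simp
  | succ n ih =>
    intro h q
    have h1 := J_d (derivative^[n] (W m) * q)
    rw [eval_mul, eval_mul, vanish m n h 1 (by norm_num), vanish m n h (-1) (by norm_num),
      derivative_mul, J_add, ih (by omega)] at h1
    rw [Function.iterate_succ_apply', Function.iterate_succ_apply, pow_succ]
    linarith

lemma W_monic (m : ℕ) : (W m).Monic := by
  have : (X ^ 2 - 1 : ℝ[X]).Monic := by monicity!
  exact this.pow m

lemma W_deg (m : ℕ) : (W m).natDegree = 2 * m := by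
  rw [W, natDegree_pow, show (X ^ 2 - 1 : ℝ[X]).natDegree = 2 by compute_degree!, mul_comm]

lemma top (m : ℕ) : derivative^[m] (derivative^[m] (W m)) = C ((Nat.factorial (2 * m) : ℕ) : ℝ) := by
  rw [← Function.iterate_add_apply, ← two_mul]
  have h0 : (derivative^[2 * m] (W m)).natDegree ≤ 0 := by
    have := natDegree_iterate_derivative (W m) (2 * m)
    rw [W_deg] at this; omega
  rw [eq_C_of_natDegree_le_zero h0, coeff_iterate_derivative, zero_add]
  have := (W_monic m).coeff_natDegree
  rw [W_deg] at this
  simp [this, Nat.descFactorial_self]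

lemma J_W (m : ℕ) : (-1) ^ m * J (W m) * (Nat.factorial (2 * m) : ℕ) * K m ^ 2 = 2 / (2 * m + 1) := by
  induction m with
  | zero => simp [J, W, K]; norm_num
  | succ n ih =>
    have h := J_d (X * W (n+1))
    rw [dXW, J_add, J_C, J_C] at h
    have v : ∀ a : ℝ, a ^ 2 = 1 → (W (n+1)).eval a = 0 := fun a ha => vanish (n+1) 0 (by omega) a ha
    rw [eval_mul, eval_mul, v 1 (by norm_num), v (-1) (by norm_num)] at h
    have hJ : J (W (n+1)) = - (2 * ((n:ℝ)+1)) / (2 * n + 3) * J (W n) := by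
      field_simp
      norm_num at h
      linarith
    have hK : K (n+1) = K n / (2 * ((n:ℝ)+1)) := by
      simp only [K, Nat.factorial_succ]; push_cast; field_simp; try ring
    have hF : ((Nat.factorial (2 * (n+1)) : ℕ) : ℝ) = (2*n+2) * (2*n+1) * (Nat.factorial (2 * n) : ℕ) := by
      rw [show 2 * (n+1) = 2 * n + 1 + 1 by ring, Nat.factorial_succ, Nat.factorial_succ]
      push_cast; ring
    rw [hJ, hK, hF]
    have e : (2:ℝ) / (2 * ((n+1 : ℕ):ℝ) + 1) = (2 / (2 * (n:ℝ) + 1)) * ((2 * n + 1) / (2 * n + 3)) := by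
      push_cast; field_simp; ring
    rw [e, ← ih]
    field_simp
    ring

lemma orth_lt (m n : ℕ) (h : n < m) : J (P m * P n) = 0 := by
  have : P m * P n = C (K m * K n) * (derivative^[m] (W m) * derivative^[n] (W n)) := by
    simp only [P, C_mul]; ring
  rw [this, J_C, parts m m le_rfl, ← Function.iterate_add_apply,
    iterate_derivative_eq_zero (by rw [W_deg]; omega)]
  simp [J]

lemma orth_eq (m : ℕ) : J (P m * P m) = 2 / (2 * m + 1) := by
  have : P m * P m = C (K m * K m) * (derivative^[m] (W m) * derivative^[m] (W m)) := by
    simp only [P, C_mul]; ring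
  rw [this, J_C, parts m m le_rfl, top, mul_comm (W m), J_C, ← J_W]
  ring

end Leg

/-- Orthonormality of the derivatives of Shen's basis functions
`φ_k = c_k (L_k - L_{k+2})` built from Legendre polynomials (Rodrigues' formula):
the stiffness matrix of the Legendre Galerkin method is the identity. -/
theorem stmt5 (L : ℕ → ℝ → ℝ)
    (hL : ∀ (m : ℕ) (x : ℝ), L m x =
      (1 / (2 ^ m * (Nat.factorial m : ℝ))) *
        iteratedDeriv m (fun y : ℝ => (y ^ 2 - 1) ^ m) x)
    (c : ℕ → ℝ) (hc : ∀ k : ℕ, c k = 1 / Real.sqrt (4 * (k : ℝ) + 6))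
    (φ : ℕ → ℝ → ℝ) (hφ : ∀ (k : ℕ) (x : ℝ), φ k x = c k * (L k x - L (k + 2) x)) :
    ∀ j k : ℕ,
      (∫ x in (-1:ℝ)..1, deriv (φ j) x * deriv (φ k) x) = if j = k then 1 else 0 := by
  intro j k
  have hLP : ∀ m x, L m x = (Leg.P m).eval x := by
    intro m x
    have h := congrFun (Leg.iter_eval (Leg.W m) m) x
    have hw : (fun y : ℝ => (y ^ 2 - 1) ^ m) = fun y => (Leg.W m).eval y := by
      funext y; simp [Leg.W]
    rw [hL, hw, h, Leg.P, Polynomial.eval_mul, Polynomial.eval_C, Leg.K]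
  have hd : ∀ k x, deriv (φ k) x =
      (Polynomial.C (c k * -(2 * (k:ℝ) + 3)) * Leg.P (k+1)).eval x := by
    intro k x
    have : φ k = fun x => (Polynomial.C (c k) * (Leg.P k - Leg.P (k+2))).eval x := by
      funext x; simp [hφ, hLP]
    rw [this, Polynomial.deriv, Polynomial.derivative_C_mul, Leg.dP, ← mul_assoc, ← Polynomial.C_mul]
  have key : (∫ x in (-1:ℝ)..1, deriv (φ j) x * deriv (φ k) x) =
      (c j * -(2 * (j:ℝ) + 3)) * (c k * -(2 * (k:ℝ) + 3)) * Leg.J (Leg.P (j+1) * Leg.P (k+1)) := by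
    rw [← Leg.J_C, Leg.J]
    congr 1
    funext x
    rw [hd, hd]
    simp only [Polynomial.eval_mul, Polynomial.eval_C]
    ring
  rw [key]
  split_ifs with h
  · subst h
    rw [Leg.orth_eq, hc]
    have hs : Real.sqrt (4 * (j:ℝ) + 6) ^ 2 = 4 * j + 6 := Real.sq_sqrt (by positivity)
    have hs0 : Real.sqrt (4 * (j:ℝ) + 6) ≠ 0 := (Real.sqrt_pos.2 (by positivity)).ne'
    push_cast
    have : (1 / Real.sqrt (4 * (j:ℝ) + 6)) ^ 2 = 1 / (4 * j + 6) := by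
      rw [div_pow, hs]; norm_num
    calc _ = (1 / Real.sqrt (4 * (j:ℝ) + 6)) ^ 2 * (2 * j + 3) ^ 2 * (2 / (2 * (j + 1) + 1)) := by ring
      _ = 1 := by
        rw [this, show (2 * ((j:ℝ) + 1) + 1) = 2 * j + 3 by ring,
          show (4 * (j:ℝ) + 6) = 2 * (2 * j + 3) by ring]
        field_simp
  · rcases Nat.lt_or_gt_of_ne h with h | h
    · rw [mul_comm (Leg.P (j+1)), Leg.orth_lt _ _ (by omega), mul_zero]
    · rw [Leg.orth_lt _ _ (by omega), mul_zero]
end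

section
/- For an integer m ≥ 0, let L_m : ℝ → ℝ denote the Legendre polynomial given by Rodrigues' formula L_m(x) = (1/(2^m m!)) (d/dx)^m (x² - 1)^m. For k ≥ 0 set c_k = 1/√(4k+6) and φ_k(x) = c_k (L_k(x) - L_{k+2}(x)). Then for all integers j, k ≥ 0, the mass-matrix entries b_{jk} = ∫_{-1}^{1} φ_j(x) φ_k(x) dx are given by: b_{jk} = c_j² (2/(2j+1) + 2/(2j+5)) if k = j; b_{jk} = -c_j c_k · 2/(2·min(j,k)+5) if |j - k| = 2; and b_{jk} = 0 otherwise. -/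
open Real

open Polynomial in
lemma aux_iter (p : ℝ[X]) (m : ℕ) :
    iteratedDeriv m (fun y : ℝ => p.eval y) = fun y => (derivative^[m] p).eval y := by
  induction m with
  | zero => simp
  | succ n ih =>
    rw [iteratedDeriv_succ, ih]
    ext y
    rw [Function.iterate_succ_apply']
    exact Polynomial.deriv _

open Polynomial in
lemma aux_parts (p q : ℝ[X]) (h1 : p.eval 1 = 0) (h2 : p.eval (-1) = 0) :
    ∫ x in (-1:ℝ)..1, (derivative p).eval x * q.eval x =
      - ∫ x in (-1:ℝ)..1, p.eval x * (derivative q).eval x := by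
  rw [intervalIntegral.integral_mul_deriv_eq_deriv_mul (u := fun x => p.eval x)
    (v := fun x => q.eval x) (u' := fun x => (derivative p).eval x)
    (v' := fun x => (derivative q).eval x)
    (fun x _ => p.hasDerivAt x) (fun x _ => q.hasDerivAt x)
    (Continuous.intervalIntegrable (Polynomial.continuous _) _ _)
    (Continuous.intervalIntegrable (Polynomial.continuous _) _ _)]
  simp [h1, h2]

open Polynomial in
lemma aux_vanish (m r : ℕ) (h : r < m) (x : ℝ) (hx : x ^ 2 = 1) :
    (derivative^[r] ((X ^ 2 - 1 : ℝ[X]) ^ m)).eval x = 0 := by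
  obtain ⟨s, hs⟩ := pow_sub_dvd_iterate_derivative_pow (X ^ 2 - 1 : ℝ[X]) m r
  rw [hs]
  have : m - r ≠ 0 := by omega
  simp [hx, this]

open Polynomial in
lemma aux_ibp (m i : ℕ) (h : i ≤ m) (q : ℝ[X]) :
    ∫ x in (-1:ℝ)..1, (derivative^[i] ((X ^ 2 - 1 : ℝ[X]) ^ m)).eval x * q.eval x =
      (-1) ^ i * ∫ x in (-1:ℝ)..1, ((X ^ 2 - 1 : ℝ[X]) ^ m).eval x *
        (derivative^[i] q).eval x := by
  induction i generalizing q with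
  | zero => simp
  | succ n ih =>
    rw [Function.iterate_succ_apply', aux_parts _ _ (aux_vanish m n (by omega) _ (by norm_num))
      (aux_vanish m n (by omega) _ (by norm_num)), ih (by omega), Function.iterate_succ_apply]
    ring

lemma aux_int (m : ℕ) : ∫ x in (-1:ℝ)..1, (x ^ 2 - 1) ^ m =
    (-1) ^ m * 2 ^ (2 * m + 1) * (m.factorial : ℝ) ^ 2 / ((2 * m + 1).factorial : ℝ) := by
  induction m with
  | zero => norm_num
  | succ m ih =>
    have h := intervalIntegral.integral_eq_sub_of_hasDerivAt (a := (-1:ℝ)) (b := 1)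
      (f := fun x : ℝ => x * (x ^ 2 - 1) ^ (m + 1))
      (f' := fun x : ℝ => (2 * m + 3) * (x ^ 2 - 1) ^ (m + 1) + 2 * (m + 1) * (x ^ 2 - 1) ^ m)
      (fun x _ => by
        have := (hasDerivAt_id x).mul ((((hasDerivAt_id x).pow 2).sub_const 1).pow (m + 1))
        refine this.congr_deriv ?_
        simp
        ring)
      (Continuous.intervalIntegrable (by fun_prop) _ _)
    rw [intervalIntegral.integral_add (Continuous.intervalIntegrable (by fun_prop) _ _)
      (Continuous.intervalIntegrable (by fun_prop) _ _),
      intervalIntegral.integral_const_mul, intervalIntegral.integral_const_mul, ih] at h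
    norm_num at h
    have h3 : (2 * (m:ℝ) + 3) ≠ 0 := by positivity
    have hf : ((2 * m + 1).factorial : ℝ) ≠ 0 := by positivity
    rw [show 2 * (m + 1) + 1 = (2 * m + 1) + 1 + 1 by ring, Nat.factorial_succ (2 * m + 1 + 1),
      Nat.factorial_succ (2 * m + 1), Nat.factorial_succ m]
    apply mul_left_cancel₀ h3
    rw [eq_neg_of_add_eq_zero_left h]
    push_cast
    field_simp
    ring

open Polynomial in
lemma aux_deg (m : ℕ) : ((X ^ 2 - 1 : ℝ[X]) ^ m).natDegree = 2 * m := by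
  rw [natDegree_pow, ← C_1, natDegree_X_pow_sub_C, mul_comm]

open Polynomial in
lemma aux_top (m : ℕ) : derivative^[2 * m] ((X ^ 2 - 1 : ℝ[X]) ^ m) =
    C ((2 * m).factorial : ℝ) := by
  have hd := natDegree_iterate_derivative ((X ^ 2 - 1 : ℝ[X]) ^ m) (2 * m)
  rw [aux_deg, Nat.sub_self] at hd
  rw [eq_C_of_natDegree_le_zero hd, coeff_iterate_derivative]
  have hm : ((X ^ 2 - 1 : ℝ[X]) ^ m).Monic := by
    apply Monic.pow
    rw [← C_1]
    exact monic_X_pow_sub_C _ (by norm_num)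
  have := hm.coeff_natDegree
  rw [aux_deg] at this
  simp [this, Nat.descFactorial_self]

open Polynomial in
lemma aux_orth (L : ℕ → ℝ → ℝ)
    (hL : ∀ (m : ℕ) (x : ℝ), L m x =
      (1 / (2 ^ m * (Nat.factorial m : ℝ))) *
        iteratedDeriv m (fun y : ℝ => (y ^ 2 - 1) ^ m) x) :
    (∀ m, Continuous (L m)) ∧
    ∀ j k, ∫ x in (-1:ℝ)..1, L j x * L k x = if j = k then 2 / (2 * (j:ℝ) + 1) else 0 := by
  have hP : ∀ m, L m = fun x => (1 / (2 ^ m * (Nat.factorial m : ℝ))) *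
      (derivative^[m] ((X ^ 2 - 1 : ℝ[X]) ^ m)).eval x := by
    intro m
    ext x
    rw [hL, ← congrFun (aux_iter _ m) x]
    simp
  have hlt : ∀ j k, j < k → ∫ x in (-1:ℝ)..1, L k x * L j x = 0 := by
    intro j k h
    simp only [hP]
    have := aux_ibp k k le_rfl (derivative^[j] ((X ^ 2 - 1 : ℝ[X]) ^ j))
    rw [← Function.iterate_add_apply, iterate_derivative_eq_zero
      (p := (X ^ 2 - 1 : ℝ[X]) ^ j) (x := k + j) (by rw [aux_deg]; omega)] at this
    simp only [mul_mul_mul_comm, intervalIntegral.integral_const_mul, this]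
    simp
  refine ⟨fun m => ?_, fun j k => ?_⟩
  · rw [hP]
    exact continuous_const.mul (Polynomial.continuous _)
  · rcases lt_trichotomy j k with h | h | h
    · rw [if_neg h.ne, ← hlt j k h]
      simp only [mul_comm]
    · subst h
      simp only [if_true, hP]
      have := aux_ibp j j le_rfl (derivative^[j] ((X ^ 2 - 1 : ℝ[X]) ^ j))
      rw [← Function.iterate_add_apply, ← two_mul, aux_top] at this
      simp only [mul_mul_mul_comm, intervalIntegral.integral_const_mul, this]
      simp only [eval_C, intervalIntegral.integral_mul_const, eval_pow, eval_sub, eval_X, eval_one,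
        aux_int]
      rw [Nat.factorial_succ]
      have hs : ((-1:ℝ) ^ j) * (-1) ^ j = 1 := by rw [← mul_pow]; simp
      have hf : ((2 * j).factorial : ℝ) ≠ 0 := by positivity
      have hf' : (j.factorial : ℝ) ≠ 0 := by positivity
      have h3 : (2 * (j:ℝ) + 1) ≠ 0 := by positivity
      push_cast
      field_simp
      rw [show ((-1:ℝ) ^ j) ^ 2 = 1 by rw [sq, hs]]
      ring
    · rw [if_neg h.ne', hlt k j h]



/-- Mass matrix entries `b_{jk} = ∫ φ_j φ_k` of Shen's basis
`φ_k = c_k (L_k - L_{k+2})` built from Legendre polynomials (Rodrigues' formula). -/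
theorem stmt6 (L : ℕ → ℝ → ℝ)
    (hL : ∀ (m : ℕ) (x : ℝ), L m x =
      (1 / (2 ^ m * (Nat.factorial m : ℝ))) *
        iteratedDeriv m (fun y : ℝ => (y ^ 2 - 1) ^ m) x)
    (c : ℕ → ℝ) (hc : ∀ k : ℕ, c k = 1 / Real.sqrt (4 * (k : ℝ) + 6))
    (φ : ℕ → ℝ → ℝ) (hφ : ∀ (k : ℕ) (x : ℝ), φ k x = c k * (L k x - L (k + 2) x)) :
    ∀ j k : ℕ,
      (∫ x in (-1:ℝ)..1, φ j x * φ k x) =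
        if j = k then c j ^ 2 * (2 / (2 * (j : ℝ) + 1) + 2 / (2 * (j : ℝ) + 5))
        else if j = k + 2 ∨ k = j + 2 then
          -(c j * c k) * (2 / (2 * (min j k : ℝ) + 5))
        else 0 := by
  obtain ⟨hcont, ho⟩ := aux_orth L hL
  intro j k
  have hi : ∀ a b, IntervalIntegrable (fun x => L a x * L b x) MeasureTheory.volume (-1) 1 :=
    fun a b => ((hcont a).mul (hcont b)).intervalIntegrable _ _
  have key : (∫ x in (-1:ℝ)..1, φ j x * φ k x) = (c j * c k) *
      (((∫ x in (-1:ℝ)..1, L j x * L k x) - (∫ x in (-1:ℝ)..1, L j x * L (k + 2) x)) -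
      ((∫ x in (-1:ℝ)..1, L (j + 2) x * L k x) -
        (∫ x in (-1:ℝ)..1, L (j + 2) x * L (k + 2) x))) := by
    rw [← intervalIntegral.integral_sub (hi _ _) (hi _ _),
      ← intervalIntegral.integral_sub (hi _ _) (hi _ _),
      ← intervalIntegral.integral_sub ((hi _ _).sub (hi _ _)) ((hi _ _).sub (hi _ _)),
      ← intervalIntegral.integral_const_mul]
    congr 1
    ext x
    rw [hφ, hφ]
    ring
  rw [key, ho, ho, ho, ho]
  by_cases h1 : j = k
  · subst h1
    simp
    ring
  by_cases h2 : j = k + 2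
  · subst h2
    have h5 : ¬ (k + 2 + 2 = k) := by omega
    simp [h5]
    left
    ring
  by_cases h3 : k = j + 2
  · subst h3
    simp [h2]
    left
    ring
  have h4 : ¬ (j + 2 = k) := fun h => h3 h.symm
  simp [h1, h2, h3, h4]
end

section
/- Let N ≥ 1 be an integer. Define nodes x_j = cos(jπ/N) for j = 0, ..., N and weights w_0 = w_N = π/(2N) and w_j = π/N for j = 1, ..., N-1. Then for every real polynomial p of degree at most 2N - 1, ∫_{-1}^{1} p(x)·(1 - x²)^{-1/2} dx = Σ_{j=0}^{N} w_j · p(x_j). -/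
open Real

lemma lob_sum (N : ℕ) (hN : 1 ≤ N) (w : ℕ → ℝ)
    (hw : ∀ j : ℕ, w j = if j = 0 ∨ j = N then π / (2 * N) else π / N) (f : ℕ → ℝ) :
    ∑ j ∈ Finset.range (N + 1), w j * f j =
      π / (2 * N) * ∑ j ∈ Finset.range N, (f j + f (j + 1)) := by
  obtain ⟨m, rfl⟩ : ∃ m, N = m + 1 := ⟨N - 1, by omega⟩
  have hmid : ∀ j ∈ Finset.range m, w (j + 1) * f (j + 1) =
      π / ((m + 1 : ℕ) : ℝ) * f (j + 1) := by
    intro j hj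
    rw [hw, if_neg]
    have := Finset.mem_range.mp hj
    omega
  rw [Finset.sum_range_succ, Finset.sum_range_succ', Finset.sum_congr rfl hmid,
    Finset.sum_add_distrib, Finset.sum_range_succ' (fun j => f j),
    Finset.sum_range_succ (fun j => f (j + 1)), hw, hw, if_pos (by simp), if_pos (by simp),
    ← Finset.mul_sum]
  have : ((m + 1 : ℕ) : ℝ) ≠ 0 := by positivity
  field_simp
  ring

lemma lob_T (N : ℕ) (hN : 1 ≤ N) (k : ℕ) (hk : k < 2 * N) :
    π / (2 * N) * ∑ j ∈ Finset.range N,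
      ((Polynomial.Chebyshev.T ℝ k).eval (cos ((j : ℝ) * π / N)) +
        (Polynomial.Chebyshev.T ℝ k).eval (cos (((j + 1 : ℕ) : ℝ) * π / N))) =
      ∫ x, (Polynomial.Chebyshev.T ℝ k).eval x ∂Polynomial.Chebyshev.measureT := by
  have hN0 : (N : ℝ) ≠ 0 := by positivity
  have key : π / (2 * N) * ∑ j ∈ Finset.range N,
      ((Polynomial.Chebyshev.T ℝ k).eval (cos ((j : ℝ) * π / N)) +
        (Polynomial.Chebyshev.T ℝ k).eval (cos (((j + 1 : ℕ) : ℝ) * π / N))) =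
      cos (k * π / (2 * N)) * Polynomial.Chebyshev.sumZeroes N (Polynomial.Chebyshev.T ℝ k) := by
    have h : ∀ j ∈ Finset.range N, 
      ((Polynomial.Chebyshev.T ℝ k).eval (cos ((j : ℝ) * π / N)) +
        (Polynomial.Chebyshev.T ℝ k).eval (cos (((j + 1 : ℕ) : ℝ) * π / N))) =
        2 * cos (k * π / (2 * N)) *
          (Polynomial.Chebyshev.T ℝ k).eval (cos ((2 * j + 1) / (2 * N) * π)) := by
      intro j _
      simp only [Polynomial.Chebyshev.T_real_cos, Int.cast_natCast]
      rw [cos_add_cos, ← cos_neg (k * π / (2 * N))]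
      have e1 : ((k : ℝ) * (j * π / N) + k * (((j + 1 : ℕ) : ℝ) * π / N)) / 2 =
          k * ((2 * j + 1) / (2 * N) * π) := by
        push_cast; field_simp; ring
      have e2 : ((k : ℝ) * (j * π / N) - k * (((j + 1 : ℕ) : ℝ) * π / N)) / 2 =
          -(k * π / (2 * N)) := by
        push_cast; field_simp; ring
      rw [e1, e2]; ring
    rw [Finset.sum_congr rfl h, ← Finset.mul_sum, Polynomial.Chebyshev.sumZeroes]
    field_simp
  rw [key, Polynomial.Chebyshev.integral_eq_sumZeroes (n := N) (by omega)
    (by rw [Polynomial.Chebyshev.degree_T]; simp; exact_mod_cast hk)]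
  rcases Nat.eq_zero_or_pos k with rfl | hk0
  · simp
  · rw [Polynomial.Chebyshev.sumZeroes_T_of_not_dvd, mul_zero]
    intro hd
    have := Int.le_of_dvd (by omega) hd
    omega

/-- Exactness of the Chebyshev Gauss–Lobatto quadrature with weight `(1-x²)^{-1/2}`:
the rule with nodes `x_j = cos(jπ/N)` and weights `π/(2N)` (endpoints), `π/N` (interior)
integrates exactly every polynomial of degree at most `2N-1`. -/
theorem stmt9 (N : ℕ) (hN : 1 ≤ N)
    (x : ℕ → ℝ) (hx : ∀ j : ℕ, x j = Real.cos ((j : ℝ) * π / N))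
    (w : ℕ → ℝ) (hw : ∀ j : ℕ, w j = if j = 0 ∨ j = N then π / (2 * N) else π / N)
    (p : Polynomial ℝ) (hp : p.natDegree ≤ 2 * N - 1) :
    (∫ y in (-1:ℝ)..1, p.eval y / Real.sqrt (1 - y ^ 2)) =
      ∑ j ∈ Finset.range (N + 1), w j * p.eval (x j) := by
  have h1 : (∫ y in (-1:ℝ)..1, p.eval y / Real.sqrt (1 - y ^ 2)) =
      ∫ y, p.eval y ∂Polynomial.Chebyshev.measureT := by
    rw [Polynomial.Chebyshev.integral_measureT]
    simp only [div_eq_mul_inv, Real.sqrt_inv]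
  rw [h1]
  have hmem : p ∈ Polynomial.degreeLT ℝ (2 * N) := by
    rw [Polynomial.mem_degreeLT]
    refine lt_of_le_of_lt Polynomial.degree_le_natDegree ?_
    exact_mod_cast (by omega : p.natDegree < 2 * N)
  rw [← Polynomial.Sequence.span_degreeLT (Polynomial.Chebyshev.chebyshevTsequence ℝ) (by simp),
    show Set.Iio (2 * N) = Finset.range (2 * N) by simp,
    Submodule.mem_span_image_finset_iff_exists_fun'] at hmem
  obtain ⟨c, rfl⟩ := hmem
  simp_rw [Polynomial.eval_finsetSum, Polynomial.eval_smul]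
  rw [MeasureTheory.integral_finsetSum]
  · simp_rw [smul_eq_mul, MeasureTheory.integral_const_mul, Finset.mul_sum]
    rw [Finset.sum_comm]
    refine Finset.sum_congr rfl fun i hi => ?_
    simp_rw [mul_left_comm (w _), ← Finset.mul_sum, hx]
    congr 1
    rw [lob_sum N hN w hw]
    exact (lob_T N hN i (Finset.mem_range.mp hi)).symm
  · simp_rw [← Polynomial.eval_smul]
    exact fun i hi => Polynomial.Chebyshev.integrable_measureT (by fun_prop)
end

section
/- Let p and ψ be real polynomials with ψ(-1) = ψ(1) = 0, and let w(x) = (1-x²)^{-1/2}. Then the functions x ↦ p'(x)ψ(x)w(x) and x ↦ p(x)·(d/dx)[ψ(x)w(x)] are integrable on (-1,1) and ∫_{-1}^{1} p'(x) ψ(x) w(x) dx = - ∫_{-1}^{1} p(x) · (d/dx)[ ψ(x) w(x) ] dx. -/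
open Real Polynomial MeasureTheory

theorem stmt13 (p ψ : Polynomial ℝ) (h1 : ψ.eval (-1) = 0) (h2 : ψ.eval 1 = 0)
    (w : ℝ → ℝ) (hw : ∀ x : ℝ, w x = 1 / Real.sqrt (1 - x ^ 2)) :
    IntervalIntegrable (fun x => (Polynomial.derivative p).eval x * ψ.eval x * w x)
      volume (-1) 1
    ∧ IntervalIntegrable (fun x => p.eval x * deriv (fun y : ℝ => ψ.eval y * w y) x)
      volume (-1) 1
    ∧ (∫ x in (-1:ℝ)..1, (Polynomial.derivative p).eval x * ψ.eval x * w x)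
      = -∫ x in (-1:ℝ)..1, p.eval x * deriv (fun y : ℝ => ψ.eval y * w y) x := by
  obtain ⟨r, hr⟩ := Polynomial.dvd_iff_isRoot.mpr h2
  have h3 : r.IsRoot (-1) := by
    rw [hr] at h1
    simp only [eval_mul, eval_sub, eval_X, eval_C] at h1
    rcases mul_eq_zero.mp h1 with h | h
    · norm_num at h
    · exact h
  obtain ⟨s, hs⟩ := Polynomial.dvd_iff_isRoot.mpr h3
  obtain ⟨q, hq⟩ : ∃ q : Polynomial ℝ, q = -s := ⟨_, rfl⟩
  have hψ : ∀ x, ψ.eval x * w x = q.eval x * Real.sqrt (1 - x ^ 2) := by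
    intro x
    have h4 : (1 - x ^ 2) / Real.sqrt (1 - x ^ 2) = Real.sqrt (1 - x ^ 2) := Real.div_sqrt
    rw [← h4, hw, hr, hs, hq]
    simp only [eval_mul, eval_sub, eval_X, eval_C, eval_neg]
    ring
  have hfun : (fun y : ℝ => ψ.eval y * w y) = fun x => q.eval x * Real.sqrt (1 - x ^ 2) :=
    funext hψ
  have hcont : Continuous (fun x : ℝ => q.eval x * Real.sqrt (1 - x ^ 2)) := by fun_prop
  have hwi : IntervalIntegrable (fun x : ℝ => 1 / Real.sqrt (1 - x ^ 2)) volume (-1) 1 := by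
    apply intervalIntegral.intervalIntegrable_deriv_of_nonneg (g := Real.arcsin)
    · exact Real.continuous_arcsin.continuousOn
    · intro x hx
      norm_num at hx
      exact Real.hasDerivAt_arcsin (by linarith [hx.1]) (by linarith [hx.2])
    · intro x hx
      positivity
  have hder : ∀ x ∈ Set.Ioo (-1:ℝ) 1, HasDerivAt (fun x : ℝ => q.eval x * Real.sqrt (1 - x ^ 2))
      (q.derivative.eval x * Real.sqrt (1 - x ^ 2)
        + q.eval x * (-x) * (1 / Real.sqrt (1 - x ^ 2))) x := by
    intro x hx
    have hpos : 0 < 1 - x ^ 2 := by nlinarith [hx.1, hx.2]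
    have h5 : HasDerivAt (fun x : ℝ => 1 - x ^ 2) (-(2 * x)) x := by
      simpa using (hasDerivAt_pow 2 x).const_sub 1
    have := (q.hasDerivAt x).mul (h5.sqrt hpos.ne')
    refine this.congr_deriv ?_
    have := (Real.sqrt_pos.mpr hpos).ne'
    field_simp
    try ring
  have hdi : IntervalIntegrable (fun x : ℝ => q.derivative.eval x * Real.sqrt (1 - x ^ 2)
        + q.eval x * (-x) * (1 / Real.sqrt (1 - x ^ 2))) volume (-1) 1 := by
    apply IntervalIntegrable.add
    · exact Continuous.intervalIntegrable (by fun_prop) _ _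
    · exact hwi.continuousOn_mul (Continuous.continuousOn (by fun_prop))
  have hdi' : IntervalIntegrable (deriv (fun y : ℝ => ψ.eval y * w y)) volume (-1) 1 := by
    rw [hfun]
    refine hdi.congr_uIoo ?_
    intro x hx
    rw [Set.uIoo_of_le (by norm_num)] at hx
    exact (hder x hx).deriv.symm
  have hfe : (fun x => (Polynomial.derivative p).eval x * ψ.eval x * w x)
      = fun x => (Polynomial.derivative p).eval x * (q.eval x * Real.sqrt (1 - x ^ 2)) := by
    funext x
    rw [mul_assoc, hψ]
  refine ⟨?_, ?_, ?_⟩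
  · rw [hfe]
    exact Continuous.intervalIntegrable (by fun_prop) _ _
  · exact hdi'.continuousOn_mul (Continuous.continuousOn (by fun_prop))
  · rw [hfe, intervalIntegral.integral_mul_deriv_eq_deriv_mul_of_hasDerivAt
      (u := fun x => p.eval x) (u' := fun x => p.derivative.eval x)
      (v := fun x : ℝ => q.eval x * Real.sqrt (1 - x ^ 2))]
    · norm_num
    · fun_prop
    · fun_prop
    · intro x _
      exact p.hasDerivAt x
    · intro x hx
      norm_num at hx
      rw [hfun]
      exact (hder x hx).differentiableAt.hasDerivAt
    · exact Continuous.intervalIntegrable (by fun_prop) _ _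
    · exact hdi'
end
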